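/- arXiv:math/0607272 — 3 statements merged into one kernel-verified Lean document; each statement's English description precedes it below -/
import Mathlib

section
/- Let (C_n, d_i, T_n) be a precyclic abelian group. Then ∂' ∘ N_n = N_{n−1} ∘ ∂ as homomorphisms C_n → C_{n−1}, where t_n = (−1)^n T_n, N_n = id + t_n + t_n² + ⋯ + t_n^n, ∂ = Σ_{i=0}^{n} (−1)^i d_i, and ∂' = Σ_{i=0}^{n−1} (−1)^i d_i. -/
/-- The boundary `∂ = Σ_{i=0}^{n+1} (-1)^i d_i : C_{n+1} → C_n`. -/
def bdry {C : ℕ → Type*} [∀ n, AddCommGroup (C n)]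
    (d : ∀ n, ℕ → (C (n + 1) →+ C n)) (n : ℕ) : C (n + 1) →+ C n :=
  ∑ i ∈ Finset.range (n + 2), ((-1 : ℤ) ^ i) • d n i

/-- The truncated boundary `∂' = Σ_{i=0}^{n} (-1)^i d_i : C_{n+1} → C_n`. -/
def bdry' {C : ℕ → Type*} [∀ n, AddCommGroup (C n)]
    (d : ∀ n, ℕ → (C (n + 1) →+ C n)) (n : ℕ) : C (n + 1) →+ C n :=
  ∑ i ∈ Finset.range (n + 1), ((-1 : ℤ) ^ i) • d n i

/-- Iterated composition of an additive endomorphism, as an additive hom. -/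
def hpow {M : Type*} [AddZeroClass M] (f : M →+ M) : ℕ → (M →+ M)
  | 0 => AddMonoidHom.id M
  | n + 1 => f.comp (hpow f n)

/-- The norm operator `N_n = id + t_n + t_n^2 + ⋯ + t_n^n : C_n → C_n`,
where `t_n = (-1)^n T_n`. -/
def normOp {C : ℕ → Type*} [∀ n, AddCommGroup (C n)]
    (T : ∀ n, C n →+ C n) (n : ℕ) : C n →+ C n :=
  ∑ j ∈ Finset.range (n + 1), hpow (((-1 : ℤ) ^ n) • T n) j

theorem hpow_comm_apply {M : Type*} [AddZeroClass M] (f : M →+ M) (n : ℕ) (x : M) :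
    hpow f n (f x) = f (hpow f n x) := by
  induction n with
  | zero => rfl
  | succ n ih => exact congrArg f ih

theorem hpow_add_apply {M : Type*} [AddZeroClass M] (f : M →+ M) (m n : ℕ) (x : M) :
    hpow f (m + n) x = hpow f m (hpow f n x) := by
  induction m with
  | zero => rw [Nat.zero_add]; rfl
  | succ m ih => rw [Nat.succ_add]; exact congrArg f ih

/-- If `D (i + 1) ∘ t = s ∘ D i` for `i < m`, then `D (j + k) ∘ t ^ j = s ^ j ∘ D k`
whenever `j + k ≤ m`. -/
theorem face_hpow_apply {M N : Type*} [AddZeroClass M] [AddZeroClass N] {D : ℕ → M →+ N}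
    {t : M →+ M} {s : N →+ N} {m : ℕ} (h : ∀ i < m, ∀ x, D (i + 1) (t x) = s (D i x))
    (j k : ℕ) (hjk : j + k ≤ m) (x : M) : D (j + k) (hpow t j x) = hpow s j (D k x) := by
  induction j with
  | zero => rw [Nat.zero_add]; rfl
  | succ j ih =>
    rw [Nat.succ_add]
    exact (h (j + k) (by omega) _).trans (congrArg s (ih (by omega)))

/-- The norm identity for faces `D i` which absorb their signs and which are cyclically permuted
by the operators `t` and `s`. -/
theorem sum_face_hpow {M N : Type*} [AddZeroClass M] [AddCommMonoid N] {D : ℕ → M →+ N}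
    {t : M →+ M} {s : N →+ N} {n : ℕ} (h0 : ∀ x, D 0 (t x) = D (n + 1) x)
    (h : ∀ i < n + 1, ∀ x, D (i + 1) (t x) = s (D i x)) (x : M) :
    ∑ i ∈ Finset.range (n + 1), ∑ j ∈ Finset.range (n + 2), D i (hpow t j x) =
      ∑ j ∈ Finset.range (n + 1), ∑ k ∈ Finset.range (n + 2), hpow s j (D k x) := by
  rw [← Finset.sum_product', ← Finset.sum_product']
  refine Finset.sum_nbij'
    (fun p => if p.2 ≤ p.1 then (p.2, p.1 - p.2) else (p.2 - 1, n + 2 + p.1 - p.2))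
    (fun p => if p.1 + p.2 ≤ n then (p.1 + p.2, p.1) else (p.1 + p.2 - (n + 1), p.1 + 1))
    ?_ ?_ ?_ ?_ ?_
  · rintro ⟨i, j⟩ hp
    simp only [Finset.mem_product, Finset.mem_range] at hp ⊢
    split_ifs <;> dsimp only <;> omega
  · rintro ⟨i, j⟩ hp
    simp only [Finset.mem_product, Finset.mem_range] at hp ⊢
    split_ifs <;> dsimp only <;> omega
  · rintro ⟨i, j⟩ hp
    simp only [Finset.mem_product, Finset.mem_range] at hp
    grind
  · rintro ⟨i, j⟩ hp
    simp only [Finset.mem_product, Finset.mem_range] at hp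
    grind
  · rintro ⟨i, j⟩ hp
    simp only [Finset.mem_product, Finset.mem_range] at hp
    dsimp only
    split_ifs with hij
    · obtain ⟨k, rfl⟩ := Nat.exists_eq_add_of_le hij
      simpa using face_hpow_apply h j k (by omega) x
    · obtain ⟨l, rfl⟩ : ∃ l, j = i + (1 + l) := ⟨j - i - 1, by omega⟩
      obtain ⟨k, hk⟩ : ∃ k, n + 1 = l + k := ⟨n + 1 - l, by omega⟩
      have e1 : n + 2 + i - (i + (1 + l)) = k := by omega
      have e2 : i + (1 + l) - 1 = i + l := by omega
      rw [e1, e2, hpow_add_apply t, hpow_add_apply s]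
      have hi := face_hpow_apply h i 0 (by omega) (hpow t (1 + l) x)
      rw [Nat.add_zero] at hi
      rw [hi, Nat.add_comm 1 l]
      congr 1
      refine (h0 (hpow t l x)).trans ?_
      rw [hk]
      exact face_hpow_apply h l k hk.ge x

/-- For a precyclic abelian group `(C_n, d_i, T_n)`,
`∂' ∘ N_n = N_{n-1} ∘ ∂` as homomorphisms `C_n → C_{n-1}`. -/
theorem stmt5 (C : ℕ → Type*) [∀ n, AddCommGroup (C n)]
    (d : ∀ n, ℕ → (C (n + 1) →+ C n))
    (hd : ∀ n i j, i < j → j ≤ n + 2 →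
      (d n i).comp (d (n + 1) j) = (d n (j - 1)).comp (d (n + 1) i))
    (T : ∀ n, C n →+ C n)
    (hT : ∀ n, hpow (T n) (n + 1) = AddMonoidHom.id (C n))
    (hT0 : ∀ n, (d n 0).comp (T (n + 1)) = d n (n + 1))
    (hTi : ∀ n i, 1 ≤ i → i ≤ n + 1 →
      (d n i).comp (T (n + 1)) = (T n).comp (d n (i - 1))) :
    ∀ n : ℕ, (bdry' d n).comp (normOp T (n + 1)) = (normOp T n).comp (bdry d n) := by
  intro n
  ext x
  have h0 : ∀ x, (((-1 : ℤ) ^ 0) • d n 0) ((((-1 : ℤ) ^ (n + 1)) • T (n + 1)) x) =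
      (((-1 : ℤ) ^ (n + 1)) • d n (n + 1)) x := fun x => by
    simpa using congrArg (((-1 : ℤ) ^ (n + 1)) • ·) (DFunLike.congr_fun (hT0 n) x)
  have h : ∀ i < n + 1, ∀ x,
      (((-1 : ℤ) ^ (i + 1)) • d n (i + 1)) ((((-1 : ℤ) ^ (n + 1)) • T (n + 1)) x) =
        (((-1 : ℤ) ^ n) • T n) ((((-1 : ℤ) ^ i) • d n i) x) := fun i hi x => by
    have e : d n (i + 1) (T (n + 1) x) = T n (d n i x) :=
      DFunLike.congr_fun (hTi n (i + 1) (by omega) (by omega)) x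
    simp only [AddMonoidHom.smul_apply, map_zsmul, e, smul_smul]
    congr 1
    ring
  simpa only [bdry', bdry, normOp, AddMonoidHom.comp_apply, AddMonoidHom.finsetSum_apply, map_sum]
    using Finset.sum_comm.trans
      ((sum_face_hpow (D := fun i => ((-1 : ℤ) ^ i) • d n i) h0 h x).trans Finset.sum_comm)
end

section
/- Let (C_n, d_i, T_n) be a precyclic abelian group equipped with a last degeneracy s_n. Let CC^{{2}} denote the double complex consisting of columns 0 and 1 of the cyclic bicomplex CC(C): both columns have entries C_q, the vertical differential in column 0 is ∂, the vertical differential in column 1 is −∂', and the horizontal differential from column 1 to column 0 is 1 − t. Then the inclusion of the complex (C_•, ∂) as the 0-th column of CC^{{2}} is a quasi-isomorphism: the induced map H_n(C_•, ∂) → H_n(Tot(CC^{{2}})) is an isomorphism for every n. -/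
/-- The differential `Tot₁(CC^{2}) = C_1 × C_0 → C_0 = Tot₀(CC^{2})`,
`(x, y) ↦ ∂x + (1 - t_0) y`. -/
def Dtwo₀ {C : ℕ → Type*} [∀ n, AddCommGroup (C n)]
    (d : ∀ n, ℕ → (C (n + 1) →+ C n)) (T : ∀ n, C n →+ C n) :
    C 1 × C 0 → C 0 :=
  fun p => bdry d 0 p.1 + (AddMonoidHom.id (C 0) - ((-1 : ℤ) ^ (0 : ℕ)) • T 0) p.2

/-- The differential `Tot_{n+2}(CC^{2}) = C_{n+2} × C_{n+1} → C_{n+1} × C_n =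
Tot_{n+1}(CC^{2})`, `(x, y) ↦ (∂x + (1 - t_{n+1}) y, -∂' y)`. -/
def Dtwo {C : ℕ → Type*} [∀ n, AddCommGroup (C n)]
    (d : ∀ n, ℕ → (C (n + 1) →+ C n)) (T : ∀ n, C n →+ C n) (n : ℕ) :
    C (n + 2) × C (n + 1) → C (n + 1) × C n :=
  fun p => (bdry d (n + 1) p.1
      + (AddMonoidHom.id (C (n + 1)) - ((-1 : ℤ) ^ (n + 1)) • T (n + 1)) p.2,
    -(bdry' d n p.2))

/-- The commutation `∂ (1 - t) = (1 - t) ∂'` of the cyclic bicomplex. -/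
lemma bdry_one_sub_cyclic {C : ℕ → Type*} [∀ n, AddCommGroup (C n)]
    (d : ∀ n, ℕ → (C (n + 1) →+ C n)) (T : ∀ n, C n →+ C n)
    (hT0 : ∀ n, (d n 0).comp (T (n + 1)) = d n (n + 1))
    (hTi : ∀ n i, 1 ≤ i → i ≤ n + 1 →
      (d n i).comp (T (n + 1)) = (T n).comp (d n (i - 1))) (n : ℕ) (c : C (n + 1)) :
    bdry d n ((AddMonoidHom.id (C (n + 1)) - ((-1 : ℤ) ^ (n + 1)) • T (n + 1)) c) =
      (AddMonoidHom.id (C n) - ((-1 : ℤ) ^ n) • T n) (bdry' d n c) := by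
  have hbdry (x : C (n + 1)) :
      bdry d n x = bdry' d n x + ((-1 : ℤ) ^ (n + 1)) • d n (n + 1) x := by
    simp [bdry, bdry', Finset.sum_range_succ _ (n + 1)]
  have hbdryT : bdry d n (T (n + 1) c) = d n (n + 1) c - T n (bdry' d n c) := by
    have h0 : d n 0 (T (n + 1) c) = d n (n + 1) c := DFunLike.congr_fun (hT0 n) c
    have hi : ∀ i ∈ Finset.range (n + 1), ((-1 : ℤ) ^ (i + 1)) • d n (i + 1) (T (n + 1) c) =
        -(((-1 : ℤ) ^ i) • T n (d n i c)) := fun i hi => by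
      have h : d n (i + 1) (T (n + 1) c) = T n (d n i c) :=
        DFunLike.congr_fun (hTi n (i + 1) (by simp) (by simp at hi; omega)) c
      rw [h, pow_succ, mul_neg_one, neg_smul]
    simp only [bdry, bdry', AddMonoidHom.finsetSum_apply, AddMonoidHom.smul_apply, map_sum,
      map_zsmul]
    rw [Finset.sum_range_succ', Finset.sum_congr rfl hi, Finset.sum_neg_distrib, pow_zero,
      one_smul, h0]
    abel
  simp only [AddMonoidHom.sub_apply, AddMonoidHom.id_apply, AddMonoidHom.smul_apply, map_sub,
    map_zsmul]
  rw [hbdryT, hbdry, pow_succ, mul_neg_one, neg_smul, neg_smul, smul_sub]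
  abel

/-- In positive degrees `s` is, up to sign, a contracting homotopy of `(C, ∂')`. -/
lemma bdry'_degeneracy {C : ℕ → Type*} [∀ n, AddCommGroup (C n)]
    (d : ∀ n, ℕ → (C (n + 1) →+ C n)) (s : ∀ n, C n →+ C (n + 1))
    (hs : ∀ n i, i ≤ n → (d (n + 1) i).comp (s (n + 1)) = (s n).comp (d n i))
    (hsn : ∀ n, (d n n).comp (s n) = AddMonoidHom.id (C n)) (n : ℕ) (y : C (n + 1)) :
    bdry' d (n + 1) (s (n + 1) y) = s n (bdry' d n y) + ((-1 : ℤ) ^ (n + 1)) • y := by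
  have hi : ∀ i ∈ Finset.range (n + 1), ((-1 : ℤ) ^ i) • d (n + 1) i (s (n + 1) y) =
      ((-1 : ℤ) ^ i) • s n (d n i y) := fun i hi => by
    have h : d (n + 1) i (s (n + 1) y) = s n (d n i y) :=
      DFunLike.congr_fun (hs n i (by simp at hi; omega)) y
    rw [h]
  have hn : d (n + 1) (n + 1) (s (n + 1) y) = y := DFunLike.congr_fun (hsn (n + 1)) y
  simp only [bdry', AddMonoidHom.finsetSum_apply, AddMonoidHom.smul_apply, map_sum, map_zsmul]
  rw [Finset.sum_range_succ, Finset.sum_congr rfl hi, hn]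

/-- The complex `(C, ∂')` is acyclic in positive degrees. -/
lemma exists_bdry'_eq {C : ℕ → Type*} [∀ n, AddCommGroup (C n)]
    (d : ∀ n, ℕ → (C (n + 1) →+ C n)) (s : ∀ n, C n →+ C (n + 1))
    (hs : ∀ n i, i ≤ n → (d (n + 1) i).comp (s (n + 1)) = (s n).comp (d n i))
    (hsn : ∀ n, (d n n).comp (s n) = AddMonoidHom.id (C n)) (n : ℕ) (y : C (n + 1))
    (hy : bdry' d n y = 0) : ∃ c, bdry' d (n + 1) c = y := by
  refine ⟨((-1 : ℤ) ^ (n + 1)) • s (n + 1) y, ?_⟩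
  rw [map_zsmul, bdry'_degeneracy d s hs hsn, hy, map_zero, zero_add, smul_smul,
    ← mul_pow, neg_one_mul, neg_neg, one_pow, one_smul]

/-- For a precyclic abelian group `(C_n, d_i, T_n)` with a last
degeneracy, the inclusion of the complex `(C_•, ∂)` as the `0`-th column of the
two-column bicomplex `CC^{2}` is a quasi-isomorphism: the induced map
`H_n(C_•, ∂) → H_n(Tot(CC^{2}))`, `[x] ↦ [(x, 0)]`, is injective and surjective
in every degree.  (Here `Tot₀ = C_0`, `Tot_{n+1} = C_{n+1} × C_n`, with the
differentials `Dtwo₀` and `Dtwo`.) -/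
theorem stmt7 (C : ℕ → Type*) [∀ n, AddCommGroup (C n)]
    (d : ∀ n, ℕ → (C (n + 1) →+ C n))
    (hd : ∀ n i j, i < j → j ≤ n + 2 →
      (d n i).comp (d (n + 1) j) = (d n (j - 1)).comp (d (n + 1) i))
    (T : ∀ n, C n →+ C n)
    (hT : ∀ n, hpow (T n) (n + 1) = AddMonoidHom.id (C n))
    (hT0 : ∀ n, (d n 0).comp (T (n + 1)) = d n (n + 1))
    (hTi : ∀ n i, 1 ≤ i → i ≤ n + 1 →
      (d n i).comp (T (n + 1)) = (T n).comp (d n (i - 1)))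
    (s : ∀ n, C n →+ C (n + 1))
    (hs : ∀ n i, i ≤ n → (d (n + 1) i).comp (s (n + 1)) = (s n).comp (d n i))
    (hsn : ∀ n, (d n n).comp (s n) = AddMonoidHom.id (C n))
    (hsn1 : ∀ n, (d n (n + 1)).comp (s n) = AddMonoidHom.id (C n)) :
    -- injectivity in degree 0
    (∀ x : C 0, (∃ p : C 1 × C 0, Dtwo₀ d T p = x) → ∃ a : C 1, bdry d 0 a = x) ∧
    -- injectivity in degree `n + 1`
    (∀ n : ℕ, ∀ x : C (n + 1), bdry d n x = 0 →
      (∃ p : C (n + 2) × C (n + 1), Dtwo d T n p = (x, 0)) →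
      ∃ a : C (n + 2), bdry d (n + 1) a = x) ∧
    -- surjectivity in degree 0
    (∀ z : C 0, ∃ x : C 0, ∃ p : C 1 × C 0, Dtwo₀ d T p = z - x) ∧
    -- surjectivity in degree 1
    (∀ z : C 1 × C 0, Dtwo₀ d T z = 0 →
      ∃ x : C 1, bdry d 0 x = 0 ∧ ∃ w : C 2 × C 1, Dtwo d T 0 w = z - (x, 0)) ∧
    -- surjectivity in degree `n + 2`
    (∀ n : ℕ, ∀ z : C (n + 2) × C (n + 1), Dtwo d T n z = 0 →
      ∃ x : C (n + 2), bdry d (n + 1) x = 0 ∧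
        ∃ w : C (n + 3) × C (n + 2), Dtwo d T (n + 1) w = z - (x, 0)) := by
  have hcomm := bdry_one_sub_cyclic d T hT0 hTi
  have hacyc := exists_bdry'_eq d s hs hsn
  refine ⟨?_, ?_, fun z => ⟨z, 0, by simp [Dtwo₀]⟩, ?_, ?_⟩
  · rintro x ⟨⟨a, b⟩, rfl⟩
    have hb : T 0 b = b := DFunLike.congr_fun (hT 0) b
    exact ⟨a, by simp [Dtwo₀, hb]⟩
  · rintro n x - ⟨⟨a, b⟩, hp⟩
    obtain ⟨h1, h2⟩ := Prod.ext_iff.mp hp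
    obtain ⟨c, rfl⟩ := hacyc n b (neg_eq_zero.mp h2)
    exact ⟨a + (AddMonoidHom.id (C (n + 2)) - ((-1 : ℤ) ^ (n + 2)) • T (n + 2)) c, by
      rw [map_add, hcomm]; exact h1⟩
  · rintro ⟨a, b⟩ hz
    have hb : bdry' d 0 (s 0 b) = b := by
      simpa [bdry'] using DFunLike.congr_fun (hsn 0) b
    refine ⟨a + (AddMonoidHom.id (C 1) - ((-1 : ℤ) ^ 1) • T 1) (s 0 b), ?_, (0, -s 0 b), ?_⟩
    · rw [map_add, hcomm, hb]; exact hz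
    · refine Prod.ext ?_ ?_
      · simp only [Dtwo, map_zero, map_neg, Prod.fst_sub, zero_add]
        exact (sub_add_cancel_left a _).symm
      · simp [Dtwo, hb]
  · rintro n ⟨a, b⟩ hz
    obtain ⟨h1, h2⟩ := Prod.ext_iff.mp hz
    obtain ⟨c, rfl⟩ := hacyc n b (neg_eq_zero.mp h2)
    refine ⟨a + (AddMonoidHom.id (C (n + 2)) - ((-1 : ℤ) ^ (n + 2)) • T (n + 2)) c, ?_, (0, -c), ?_⟩
    · rw [map_add, hcomm]; exact h1
    · refine Prod.ext ?_ ?_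
      · simp only [Dtwo, map_zero, map_neg, Prod.fst_sub, zero_add]
        exact (sub_add_cancel_left a _).symm
      · simp [Dtwo]
end

section
/- (Connes periodicity) Let (C_n, d_i, T_n) be a precyclic abelian group equipped with a last degeneracy s_n. Let H_n denote the n-th homology of the complex (C_•, ∂) and HC_n the n-th homology of the total complex of the cyclic bicomplex CC(C). Then there exist homomorphisms I : H_n → HC_n, S : HC_n → HC_{n−2}, and B : HC_{n−2} → H_{n−1} fitting into a long exact sequence ⋯ →^B H_n →^I HC_n →^S HC_{n−2} →^B H_{n−1} →^I HC_{n−1} → ⋯, arising as the homology long exact sequence of the short exact sequence of bicomplexes 0 → CC^{{2}} → CC(C) → CC(C)[2,0] → 0. -/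
/-- Total complex of the cyclic bicomplex `CC(C)` in degree `n`:
`Tot_n = ⊕_{p+q=n, p ≥ 0} C_q`, recorded as a function assigning to each row
`q ≤ n` the entry in column `p = n - q`. -/
abbrev TotCC (C : ℕ → Type*) (n : ℕ) : Type _ := ∀ q : Fin (n + 1), C q

/-- The total differential `Tot_{n+1} → Tot_n` of the cyclic bicomplex: the row-`q`
component of `D x` receives the horizontal differential (`1 - t_q` into even columns,
`N_q` into odd columns) from the row-`q` entry of `x`, plus the vertical differential
(`∂` in even columns, `-∂'` in odd columns) from the row-`(q+1)` entry of `x`;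
the row-`q` entry of `Tot_n` lies in column `n - q`. -/
def Dtot {C : ℕ → Type*} [∀ n, AddCommGroup (C n)]
    (d : ∀ n, ℕ → (C (n + 1) →+ C n)) (T : ∀ n, C n →+ C n) (n : ℕ) :
    TotCC C (n + 1) →+ TotCC C n :=
  AddMonoidHom.mk' (fun x q =>
    if Even (n - (q : ℕ)) then
      (AddMonoidHom.id (C q) - ((-1 : ℤ) ^ (q : ℕ)) • T q) (x q.castSucc)
        + bdry d q (x q.succ)
    else
      (∑ j ∈ Finset.range ((q : ℕ) + 1), hpow (((-1 : ℤ) ^ (q : ℕ)) • T q) j)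
          (x q.castSucc)
        - bdry' d q (x q.succ))
    (by
      intro a b
      funext q
      by_cases h : Even (n - (q : ℕ)) <;>
        simp only [h, if_true, if_false, Pi.add_apply, map_add] <;>
        abel)

/-- Cycles of the complex `(C_•, ∂)`. -/
def cycC {C : ℕ → Type*} [∀ n, AddCommGroup (C n)]
    (d : ∀ n, ℕ → (C (n + 1) →+ C n)) : ∀ n, AddSubgroup (C n)
  | 0 => ⊤
  | n + 1 => (bdry d n).ker

/-- Boundaries of the complex `(C_•, ∂)`. -/
def bdC {C : ℕ → Type*} [∀ n, AddCommGroup (C n)]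
    (d : ∀ n, ℕ → (C (n + 1) →+ C n)) (n : ℕ) : AddSubgroup (C n) :=
  (bdry d n).range

/-- The homology `H_n` of the complex `(C_•, ∂)`. -/
abbrev Hgrp {C : ℕ → Type*} [∀ n, AddCommGroup (C n)]
    (d : ∀ n, ℕ → (C (n + 1) →+ C n)) (n : ℕ) : Type _ :=
  cycC d n ⧸ ((bdC d n).addSubgroupOf (cycC d n))

/-- Cycles of the total complex of the cyclic bicomplex. -/
def cycTot {C : ℕ → Type*} [∀ n, AddCommGroup (C n)]
    (d : ∀ n, ℕ → (C (n + 1) →+ C n)) (T : ∀ n, C n →+ C n) :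
    ∀ n, AddSubgroup (TotCC C n)
  | 0 => ⊤
  | n + 1 => (Dtot d T n).ker

/-- Boundaries of the total complex of the cyclic bicomplex. -/
def bdTot {C : ℕ → Type*} [∀ n, AddCommGroup (C n)]
    (d : ∀ n, ℕ → (C (n + 1) →+ C n)) (T : ∀ n, C n →+ C n) (n : ℕ) :
    AddSubgroup (TotCC C n) :=
  (Dtot d T n).range

/-- The cyclic homology `HC_n`, i.e. the homology of the total complex of the
cyclic bicomplex `CC(C)`. -/
abbrev HCgrp {C : ℕ → Type*} [∀ n, AddCommGroup (C n)]
    (d : ∀ n, ℕ → (C (n + 1) →+ C n)) (T : ∀ n, C n →+ C n) (n : ℕ) : Type _ :=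
  cycTot d T n ⧸ ((bdTot d T n).addSubgroupOf (cycTot d T n))


section CyclicBicomplex

variable {C : ℕ → Type*} [∀ n, AddCommGroup (C n)]

/-- The operator `1 - t` on `C_n`. -/
def oneSubT (T : ∀ n, C n →+ C n) (n : ℕ) : C n →+ C n :=
  AddMonoidHom.id (C n) - ((-1 : ℤ) ^ n) • T n

/-- The norm operator `N = 1 + t + ⋯ + t^n` on `C_n`. -/
def normT (T : ∀ n, C n →+ C n) (n : ℕ) : C n →+ C n :=
  ∑ j ∈ Finset.range (n + 1), hpow (((-1 : ℤ) ^ n) • T n) j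

/-- The signed last degeneracy, a contracting homotopy of `(C_•, ∂')`. -/
def contr (s : ∀ n, C n →+ C (n + 1)) (n : ℕ) : C n →+ C (n + 1) :=
  ((-1 : ℤ) ^ n) • s n

/-! ### Identities between the operators of the bicomplex -/

theorem hpow_apply_comm {M : Type*} [AddZeroClass M] (f : M →+ M) (k : ℕ) (x : M) :
    hpow f k (f x) = f (hpow f k x) := by
  induction k with
  | zero => rfl
  | succ k ih => exact congrArg f ih

theorem hpow_zsmul_apply {M : Type*} [AddCommGroup M] (f : M →+ M) (a : ℤ) (k : ℕ) (x : M) :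
    hpow (a • f) k x = a ^ k • hpow f k x := by
  induction k with
  | zero => simp [hpow]
  | succ k ih =>
    simp only [hpow, AddMonoidHom.comp_apply, ih, AddMonoidHom.smul_apply, map_zsmul, smul_smul]
    rw [mul_comm, pow_succ']

theorem hpow_signed (T : ∀ n, C n →+ C n)
    (hT : ∀ n, hpow (T n) (n + 1) = AddMonoidHom.id (C n)) (n : ℕ) (x : C n) :
    hpow (((-1 : ℤ) ^ n) • T n) (n + 1) x = x := by
  rw [hpow_zsmul_apply, hT, ← pow_mul, (Nat.even_mul_succ_self n).neg_one_pow]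
  simp

theorem normT_apply (T : ∀ n, C n →+ C n) (n : ℕ) (x : C n) :
    normT T n x = ∑ j ∈ Finset.range (n + 1), hpow (((-1 : ℤ) ^ n) • T n) j x := by
  simp [normT, AddMonoidHom.finsetSum_apply]

theorem signed_normT (T : ∀ n, C n →+ C n)
    (hT : ∀ n, hpow (T n) (n + 1) = AddMonoidHom.id (C n)) (n : ℕ) (x : C n) :
    (((-1 : ℤ) ^ n) • T n) (normT T n x) = normT T n x := by
  rw [normT_apply, map_sum]
  change ∑ j ∈ Finset.range (n + 1), hpow (((-1 : ℤ) ^ n) • T n) (j + 1) x = _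
  rw [Finset.sum_range_succ, hpow_signed T hT, Finset.sum_range_succ']
  rfl

theorem normT_signed (T : ∀ n, C n →+ C n)
    (hT : ∀ n, hpow (T n) (n + 1) = AddMonoidHom.id (C n)) (n : ℕ) (x : C n) :
    normT T n ((((-1 : ℤ) ^ n) • T n) x) = normT T n x := by
  rw [← signed_normT T hT n x, normT_apply, normT_apply, map_sum]
  exact Finset.sum_congr rfl fun j _ => hpow_apply_comm _ j x

theorem oneSubT_normT (T : ∀ n, C n →+ C n)
    (hT : ∀ n, hpow (T n) (n + 1) = AddMonoidHom.id (C n)) (n : ℕ) (x : C n) :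
    oneSubT T n (normT T n x) = 0 := by
  rw [oneSubT, AddMonoidHom.sub_apply, signed_normT T hT]
  exact sub_self _

theorem normT_oneSubT (T : ∀ n, C n →+ C n)
    (hT : ∀ n, hpow (T n) (n + 1) = AddMonoidHom.id (C n)) (n : ℕ) (x : C n) :
    normT T n (oneSubT T n x) = 0 := by
  rw [oneSubT, AddMonoidHom.sub_apply, map_sub, normT_signed T hT]
  exact sub_self _

theorem bdry_apply (d : ∀ n, ℕ → (C (n + 1) →+ C n)) (n : ℕ) (x : C (n + 1)) :
    bdry d n x = ∑ i ∈ Finset.range (n + 2), ((-1 : ℤ) ^ i) • d n i x := by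
  simp [bdry, AddMonoidHom.finsetSum_apply]

theorem bdry'_apply (d : ∀ n, ℕ → (C (n + 1) →+ C n)) (n : ℕ) (x : C (n + 1)) :
    bdry' d n x = ∑ i ∈ Finset.range (n + 1), ((-1 : ℤ) ^ i) • d n i x := by
  simp [bdry', AddMonoidHom.finsetSum_apply]

theorem alternating_sum_faces_eq_zero (d : ∀ n, ℕ → (C (n + 1) →+ C n))
    (hd : ∀ n i j, i < j → j ≤ n + 2 →
      (d n i).comp (d (n + 1) j) = (d n (j - 1)).comp (d (n + 1) i))
    (n m : ℕ) (hm : m ≤ n + 2) (x : C (n + 2)) :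
    ∑ i ∈ Finset.range m, ((-1 : ℤ) ^ i) •
      d n i (∑ j ∈ Finset.range (m + 1), ((-1 : ℤ) ^ j) • d (n + 1) j x) = 0 := by
  simp only [map_sum, map_zsmul, Finset.smul_sum, smul_smul, ← pow_add]
  rw [← Finset.sum_product']
  refine Finset.sum_involution
    (fun p _ => if p.1 < p.2 then (p.2 - 1, p.1) else (p.2, p.1 + 1)) ?_ ?_ ?_ ?_
  · rintro ⟨i, j⟩ hp
    simp only [Finset.mem_product, Finset.mem_range] at hp
    by_cases h : i < j
    · have := DFunLike.congr_fun (hd n i j h (by omega)) x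
      simp only [AddMonoidHom.comp_apply] at this
      obtain ⟨j, rfl⟩ : ∃ k, j = k + 1 := ⟨j - 1, by omega⟩
      simp only [h, if_true, this, Nat.add_sub_cancel, ← add_smul]
      rw [show (-1 : ℤ) ^ (i + (j + 1)) + (-1) ^ (j + i) = 0 by ring, zero_smul]
    · have := DFunLike.congr_fun (hd n j (i + 1) (by omega) (by omega)) x
      simp only [AddMonoidHom.comp_apply, Nat.add_sub_cancel] at this
      simp only [h, if_false, this, ← add_smul]
      rw [show (-1 : ℤ) ^ (i + j) + (-1) ^ (j + (i + 1)) = 0 by ring, zero_smul]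
  · rintro ⟨i, j⟩ - -
    simp only [ne_eq]
    split_ifs <;> simp only [Prod.mk.injEq] <;> omega
  · rintro ⟨i, j⟩ hp
    simp only [Finset.mem_product, Finset.mem_range] at hp ⊢
    split_ifs <;> dsimp only <;> omega
  · rintro ⟨i, j⟩ hp
    by_cases h : i < j
    · have h' : ¬ j - 1 < i := by omega
      simp only [h, h', if_true, if_false, Prod.mk.injEq, true_and]
      omega
    · have h' : j < i + 1 := by omega
      simp only [h, h', if_true, if_false, Nat.add_sub_cancel]

theorem bdry_bdry (d : ∀ n, ℕ → (C (n + 1) →+ C n))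
    (hd : ∀ n i j, i < j → j ≤ n + 2 →
      (d n i).comp (d (n + 1) j) = (d n (j - 1)).comp (d (n + 1) i))
    (n : ℕ) (x : C (n + 2)) : bdry d n (bdry d (n + 1) x) = 0 := by
  rw [bdry_apply, bdry_apply]
  exact alternating_sum_faces_eq_zero d hd n (n + 2) le_rfl x

theorem bdry'_bdry' (d : ∀ n, ℕ → (C (n + 1) →+ C n))
    (hd : ∀ n i j, i < j → j ≤ n + 2 →
      (d n i).comp (d (n + 1) j) = (d n (j - 1)).comp (d (n + 1) i))
    (n : ℕ) (x : C (n + 2)) : bdry' d n (bdry' d (n + 1) x) = 0 := by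
  rw [bdry'_apply, bdry'_apply]
  exact alternating_sum_faces_eq_zero d hd n (n + 1) (by omega) x

theorem signed_face_succ_signed (d : ∀ n, ℕ → (C (n + 1) →+ C n)) (T : ∀ n, C n →+ C n)
    (hTi : ∀ n i, 1 ≤ i → i ≤ n + 1 →
      (d n i).comp (T (n + 1)) = (T n).comp (d n (i - 1)))
    (n i : ℕ) (hi : i ≤ n) (x : C (n + 1)) :
    ((-1 : ℤ) ^ (i + 1)) • d n (i + 1) ((((-1 : ℤ) ^ (n + 1)) • T (n + 1)) x) =
      (((-1 : ℤ) ^ n) • T n) (((-1 : ℤ) ^ i) • d n i x) := by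
  have h := DFunLike.congr_fun (hTi n (i + 1) (by omega) (by omega)) x
  simp only [AddMonoidHom.comp_apply, Nat.add_sub_cancel] at h
  simp only [AddMonoidHom.smul_apply, map_zsmul, h, smul_smul]
  congr 1
  ring

theorem face_zero_signed (d : ∀ n, ℕ → (C (n + 1) →+ C n)) (T : ∀ n, C n →+ C n)
    (hT0 : ∀ n, (d n 0).comp (T (n + 1)) = d n (n + 1)) (n : ℕ) (x : C (n + 1)) :
    d n 0 ((((-1 : ℤ) ^ (n + 1)) • T (n + 1)) x) = ((-1 : ℤ) ^ (n + 1)) • d n (n + 1) x := by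
  rw [← hT0]
  simp

theorem bdry_oneSubT (d : ∀ n, ℕ → (C (n + 1) →+ C n)) (T : ∀ n, C n →+ C n)
    (hT0 : ∀ n, (d n 0).comp (T (n + 1)) = d n (n + 1))
    (hTi : ∀ n i, 1 ≤ i → i ≤ n + 1 →
      (d n i).comp (T (n + 1)) = (T n).comp (d n (i - 1)))
    (n : ℕ) (x : C (n + 1)) :
    bdry d n (oneSubT T (n + 1) x) = oneSubT T n (bdry' d n x) := by
  have h : bdry d n ((((-1 : ℤ) ^ (n + 1)) • T (n + 1)) x) =
      (((-1 : ℤ) ^ n) • T n) (bdry' d n x) + ((-1 : ℤ) ^ (n + 1)) • d n (n + 1) x := by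
    rw [bdry_apply, Finset.sum_range_succ', bdry'_apply, map_sum, pow_zero, one_smul,
      face_zero_signed d T hT0]
    congr 1
    refine Finset.sum_congr rfl fun i hi => signed_face_succ_signed d T hTi n i ?_ x
    have := Finset.mem_range.1 hi
    omega
  have h' : bdry d n x = bdry' d n x + ((-1 : ℤ) ^ (n + 1)) • d n (n + 1) x := by
    rw [bdry_apply, bdry'_apply, Finset.sum_range_succ]
  simp only [oneSubT, AddMonoidHom.sub_apply, AddMonoidHom.id_apply, map_sub, h, h']
  abel

theorem bdry'_normT (d : ∀ n, ℕ → (C (n + 1) →+ C n)) (T : ∀ n, C n →+ C n)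
    (hT : ∀ n, hpow (T n) (n + 1) = AddMonoidHom.id (C n))
    (hT0 : ∀ n, (d n 0).comp (T (n + 1)) = d n (n + 1))
    (hTi : ∀ n i, 1 ≤ i → i ≤ n + 1 →
      (d n i).comp (T (n + 1)) = (T n).comp (d n (i - 1)))
    (n : ℕ) (x : C (n + 1)) :
    bdry' d n (normT T (n + 1) x) = normT T n (bdry d n x) := by
  -- Both sides equal `N d₀ N x`.
  have hl : ∀ i ≤ n, ((-1 : ℤ) ^ i) • d n i (normT T (n + 1) x) =
      hpow (((-1 : ℤ) ^ n) • T n) i (d n 0 (normT T (n + 1) x)) := by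
    intro i
    induction i with
    | zero => simp [hpow]
    | succ i ih =>
      intro hi
      conv_lhs => rw [← signed_normT T hT]
      rw [signed_face_succ_signed d T hTi n i (by omega), ih (by omega)]
      rfl
  have hr : ∀ k ≤ n + 1, ∀ x, normT T n (((-1 : ℤ) ^ (n + 1 - k)) • d n (n + 1 - k) x) =
      normT T n (d n 0 ((((-1 : ℤ) ^ (n + 1)) • T (n + 1))
        (hpow (((-1 : ℤ) ^ (n + 1)) • T (n + 1)) k x))) := by
    intro k
    induction k with
    | zero =>
      intro _ x
      rw [face_zero_signed d T hT0]
      rfl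
    | succ k ih =>
      intro hk x
      rw [← normT_signed T hT, ← signed_face_succ_signed d T hTi n _ (by omega),
        show n + 1 - (k + 1) + 1 = n + 1 - k by omega, ih (by omega), hpow_apply_comm]
      rfl
  trans normT T n (d n 0 (normT T (n + 1) x))
  · rw [bdry'_apply, normT_apply T n]
    exact Finset.sum_congr rfl fun i hi => hl i (Nat.lt_succ_iff.1 (Finset.mem_range.1 hi))
  · rw [bdry_apply, map_sum, ← Finset.sum_range_reflect, ← signed_normT T hT (n + 1) x,
      normT_apply T (n + 1), map_sum, map_sum, map_sum]
    exact Finset.sum_congr rfl fun k hk =>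
      (hr k (Nat.lt_succ_iff.1 (Finset.mem_range.1 hk)) x).symm

theorem bdry'_zero_contr (d : ∀ n, ℕ → (C (n + 1) →+ C n)) (s : ∀ n, C n →+ C (n + 1))
    (hsn : ∀ n, (d n n).comp (s n) = AddMonoidHom.id (C n)) (x : C 0) :
    bdry' d 0 (contr s 0 x) = x := by
  simpa [bdry'_apply, contr] using DFunLike.congr_fun (hsn 0) x

theorem bdry'_contr (d : ∀ n, ℕ → (C (n + 1) →+ C n)) (s : ∀ n, C n →+ C (n + 1))
    (hs : ∀ n i, i ≤ n → (d (n + 1) i).comp (s (n + 1)) = (s n).comp (d n i))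
    (hsn : ∀ n, (d n n).comp (s n) = AddMonoidHom.id (C n)) (n : ℕ) (x : C (n + 1)) :
    bdry' d (n + 1) (contr s (n + 1) x) = x - contr s n (bdry' d n x) := by
  have h1 := DFunLike.congr_fun (hsn (n + 1)) x
  simp only [AddMonoidHom.comp_apply, AddMonoidHom.id_apply] at h1
  rw [bdry'_apply, Finset.sum_range_succ, bdry'_apply, map_sum]
  simp only [contr, AddMonoidHom.smul_apply, map_zsmul, h1, smul_smul]
  rw [← pow_add, (Even.add_self (n + 1)).neg_one_pow, one_smul, sub_eq_neg_add,
    ← Finset.sum_neg_distrib]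
  congr 1
  refine Finset.sum_congr rfl fun i hi => ?_
  have h2 := DFunLike.congr_fun (hs n i (Nat.lt_succ_iff.1 (Finset.mem_range.1 hi))) x
  simp only [AddMonoidHom.comp_apply] at h2
  rw [h2, ← neg_smul]
  congr 1
  ring

/-! ### The total complex -/

/-- The column-zero entry of an element of the total complex. -/
def topEntry (n : ℕ) : TotCC C n →+ C n :=
  AddMonoidHom.mk' (fun x => x (Fin.last n)) fun _ _ => rfl

/-- Forgetting the column-zero entry. -/
def initEntries (n : ℕ) : TotCC C (n + 1) →+ TotCC C n :=
  AddMonoidHom.mk' (fun x q => x q.castSucc) fun _ _ => rfl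

/-- Adjoining a column-zero entry. -/
def snocEntry {n : ℕ} (z : TotCC C n) (a : C (n + 1)) : TotCC C (n + 1) :=
  Fin.snoc (α := fun q : Fin (n + 2) => C q) z a

/-- The inclusion of column zero in the total complex. -/
def colZero (n : ℕ) : C n →+ TotCC C n :=
  AddMonoidHom.mk' (fun a => Pi.single (M := fun q : Fin (n + 1) => C q) (Fin.last n) a)
    fun a b => Pi.single_add (f := fun q : Fin (n + 1) => C q) (Fin.last n) a b

@[simp]
theorem topEntry_snocEntry {n : ℕ} (z : TotCC C n) (a : C (n + 1)) :
    topEntry (n + 1) (snocEntry z a) = a :=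
  Fin.snoc_last (α := fun q : Fin (n + 2) => C q) a z

@[simp]
theorem initEntries_snocEntry {n : ℕ} (z : TotCC C n) (a : C (n + 1)) :
    initEntries n (snocEntry z a) = z :=
  Fin.init_snoc (α := fun q : Fin (n + 2) => C q) a z

@[simp]
theorem topEntry_colZero (n : ℕ) (a : C n) : topEntry n (colZero n a) = a :=
  Pi.single_eq_same (M := fun q : Fin (n + 1) => C q) (Fin.last n) a

@[simp]
theorem initEntries_colZero (n : ℕ) (a : C (n + 1)) :
    initEntries n (colZero (n + 1) a) = 0 :=
  funext fun q => Pi.single_eq_of_ne (M := fun q : Fin (n + 2) => C q)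
    (Fin.castSucc_lt_last q).ne a

theorem TotCC.ext_zero {x y : TotCC C 0} (h : topEntry 0 x = topEntry 0 y) : x = y := by
  funext q
  obtain rfl : q = Fin.last 0 := Fin.ext (by omega)
  exact h

theorem TotCC.ext_succ {n : ℕ} {x y : TotCC C (n + 1)}
    (hi : initEntries n x = initEntries n y) (ht : topEntry (n + 1) x = topEntry (n + 1) y) :
    x = y :=
  funext fun q => Fin.lastCases (motive := fun q => x q = y q) ht (fun q => congrFun hi q) q

theorem eq_colZero_zero (x : TotCC C 0) : x = colZero 0 (topEntry 0 x) :=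
  TotCC.ext_zero (by simp)

theorem eq_colZero_succ {n : ℕ} (x : TotCC C (n + 1)) (h : initEntries n x = 0) :
    x = colZero (n + 1) (topEntry (n + 1) x) :=
  TotCC.ext_succ (by simp [h]) (by simp)

section Differential

variable (d : ∀ n, ℕ → (C (n + 1) →+ C n)) (T : ∀ n, C n →+ C n)

theorem topEntry_Dtot (n : ℕ) (x : TotCC C (n + 1)) :
    topEntry n (Dtot d T n x) =
      oneSubT T n (topEntry n (initEntries n x)) + bdry d n (topEntry (n + 1) x) := by
  have h : Even (n - ((Fin.last n : Fin (n + 1)) : ℕ)) := by simp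
  exact if_pos h

theorem topEntry_initEntries_Dtot (n : ℕ) (x : TotCC C (n + 2)) :
    topEntry n (initEntries n (Dtot d T (n + 1) x)) =
      normT T n (topEntry n (initEntries n (initEntries (n + 1) x))) -
        bdry' d n (topEntry (n + 1) (initEntries (n + 1) x)) := by
  have h : ¬ Even (n + 1 - (((Fin.last n).castSucc : Fin (n + 2)) : ℕ)) := by simp
  exact if_neg h

theorem initEntries_initEntries_Dtot (n : ℕ) (x : TotCC C (n + 3)) :
    initEntries n (initEntries (n + 1) (Dtot d T (n + 2) x)) =
      Dtot d T n (initEntries (n + 1) (initEntries (n + 2) x)) := by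
  funext q
  have h : Even (n + 2 - ((q.castSucc.castSucc : Fin (n + 3)) : ℕ)) ↔ Even (n - (q : ℕ)) := by
    rw [Fin.val_castSucc, Fin.val_castSucc, Nat.sub_add_comm (Nat.lt_succ_iff.1 q.2)]
    simp [Nat.even_add]
  exact if_congr h rfl rfl

theorem Dtot_eq_colZero_iff (n : ℕ) (x : TotCC C (n + 2)) (a : C (n + 1)) :
    Dtot d T (n + 1) x = colZero (n + 1) a ↔
      initEntries n (initEntries (n + 1) x) ∈ cycTot d T n ∧
      normT T n (topEntry n (initEntries n (initEntries (n + 1) x))) =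
        bdry' d n (topEntry (n + 1) (initEntries (n + 1) x)) ∧
      oneSubT T (n + 1) (topEntry (n + 1) (initEntries (n + 1) x)) +
        bdry d (n + 1) (topEntry (n + 2) x) = a := by
  rw [← topEntry_Dtot, ← sub_eq_zero (a := normT T n _), ← topEntry_initEntries_Dtot]
  constructor
  · intro h
    refine ⟨?_, by simp [h], by simp [h]⟩
    cases n with
    | zero => trivial
    | succ n =>
      change _ = _
      rw [← initEntries_initEntries_Dtot, h]
      simp
  · rintro ⟨h1, h2, h3⟩
    refine TotCC.ext_succ ?_ (by simpa using h3)
    rw [initEntries_colZero]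
    cases n with
    | zero => exact TotCC.ext_zero (by simpa using h2)
    | succ n =>
      refine TotCC.ext_succ ?_ (by simpa using h2)
      rw [initEntries_initEntries_Dtot, map_zero]
      exact h1

theorem mem_cycTot_iff (n : ℕ) (x : TotCC C (n + 2)) :
    x ∈ cycTot d T (n + 2) ↔
      initEntries n (initEntries (n + 1) x) ∈ cycTot d T n ∧
      normT T n (topEntry n (initEntries n (initEntries (n + 1) x))) =
        bdry' d n (topEntry (n + 1) (initEntries (n + 1) x)) ∧
      oneSubT T (n + 1) (topEntry (n + 1) (initEntries (n + 1) x)) +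
        bdry d (n + 1) (topEntry (n + 2) x) = 0 := by
  rw [← Dtot_eq_colZero_iff, map_zero]
  rfl

theorem Dtot_colZero (n : ℕ) (a : C (n + 1)) :
    Dtot d T n (colZero (n + 1) a) = colZero n (bdry d n a) := by
  cases n with
  | zero => exact TotCC.ext_zero (by simp [topEntry_Dtot])
  | succ n =>
    rw [Dtot_eq_colZero_iff]
    simp [zero_mem]

theorem colZero_mem_cycTot (n : ℕ) (a : C n) (ha : a ∈ cycC d n) :
    colZero n a ∈ cycTot d T n := by
  cases n with
  | zero => trivial
  | succ n =>
    have ha' : bdry d n a = 0 := ha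
    change _ = _
    rw [Dtot_colZero, ha', map_zero]

/-- The periodicity map forgets columns `0` and `1`. -/
def shiftTwo (n : ℕ) : TotCC C (n + 2) →+ TotCC C n :=
  (initEntries n).comp (initEntries (n + 1))

theorem Dtot_Dtot
    (hd : ∀ n i j, i < j → j ≤ n + 2 →
      (d n i).comp (d (n + 1) j) = (d n (j - 1)).comp (d (n + 1) i))
    (hT : ∀ n, hpow (T n) (n + 1) = AddMonoidHom.id (C n))
    (hT0 : ∀ n, (d n 0).comp (T (n + 1)) = d n (n + 1))
    (hTi : ∀ n i, 1 ≤ i → i ≤ n + 1 →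
      (d n i).comp (T (n + 1)) = (T n).comp (d n (i - 1)))
    (n : ℕ) (x : TotCC C (n + 2)) :
    Dtot d T n (Dtot d T (n + 1) x) = 0 := by
  have top : ∀ n (x : TotCC C (n + 2)), topEntry n (Dtot d T n (Dtot d T (n + 1) x)) = 0 := by
    intro n x
    rw [topEntry_Dtot, topEntry_initEntries_Dtot, topEntry_Dtot, map_add, bdry_bdry d hd,
      bdry_oneSubT d T hT0 hTi, map_sub, oneSubT_normT T hT]
    abel
  have top_init : ∀ n (x : TotCC C (n + 3)),
      topEntry n (initEntries n (Dtot d T (n + 1) (Dtot d T (n + 2) x))) = 0 := by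
    intro n x
    rw [topEntry_initEntries_Dtot, topEntry_initEntries_Dtot, initEntries_initEntries_Dtot,
      topEntry_Dtot, map_add, map_sub, bdry'_normT d T hT hT0 hTi, bdry'_bdry' d hd,
      normT_oneSubT T hT]
    abel
  induction n using Nat.twoStepInduction with
  | zero => exact TotCC.ext_zero (top 0 x)
  | one => exact TotCC.ext_succ (TotCC.ext_zero (top_init 0 x)) (top 1 x)
  | more n ih _ =>
    refine TotCC.ext_succ (TotCC.ext_succ ?_ (top_init (n + 1) x)) (top (n + 2) x)
    rw [initEntries_initEntries_Dtot, initEntries_initEntries_Dtot, ih]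
    rfl

theorem bdTot_le_cycTot
    (hd : ∀ n i j, i < j → j ≤ n + 2 →
      (d n i).comp (d (n + 1) j) = (d n (j - 1)).comp (d (n + 1) i))
    (hT : ∀ n, hpow (T n) (n + 1) = AddMonoidHom.id (C n))
    (hT0 : ∀ n, (d n 0).comp (T (n + 1)) = d n (n + 1))
    (hTi : ∀ n i, 1 ≤ i → i ≤ n + 1 →
      (d n i).comp (T (n + 1)) = (T n).comp (d n (i - 1)))
    (n : ℕ) : bdTot d T n ≤ cycTot d T n := by
  cases n with
  | zero => exact fun _ _ => trivial
  | succ n =>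
    rintro _ ⟨x, rfl⟩
    exact Dtot_Dtot d T hd hT hT0 hTi n x

theorem exists_colZero_of_initEntries_eq
    (hT0 : ∀ n, (d n 0).comp (T (n + 1)) = d n (n + 1))
    (hTi : ∀ n i, 1 ≤ i → i ≤ n + 1 →
      (d n i).comp (T (n + 1)) = (T n).comp (d n (i - 1)))
    (s : ∀ n, C n →+ C (n + 1))
    (hs : ∀ n i, i ≤ n → (d (n + 1) i).comp (s (n + 1)) = (s n).comp (d n i))
    (hsn : ∀ n, (d n n).comp (s n) = AddMonoidHom.id (C n))
    (n : ℕ) (x : TotCC C (n + 1)) (hx : x ∈ cycTot d T (n + 1)) (b : C n)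
    (hb : initEntries n x = colZero n b) :
    ∃ a ∈ cycC d (n + 1), colZero (n + 1) a - x ∈ bdTot d T (n + 1) := by
  have hx0 : Dtot d T n x = 0 := hx
  have hb' : bdry' d n (contr s n b) = b := by
    cases n with
    | zero => exact bdry'_zero_contr d s hsn b
    | succ n =>
      have h := ((mem_cycTot_iff d T n x).1 hx).2.1
      rw [hb] at h
      simp only [initEntries_colZero, topEntry_colZero, map_zero] at h
      rw [bdry'_contr d s hs hsn, ← h, map_zero, sub_zero]
  have ht : oneSubT T n b + bdry d n (topEntry (n + 1) x) = 0 := by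
    rw [← topEntry_colZero n b, ← hb, ← topEntry_Dtot, hx0, map_zero]
  refine ⟨topEntry (n + 1) x + oneSubT T (n + 1) (contr s n b), ?_,
    snocEntry (snocEntry 0 (contr s n b)) 0, ?_⟩
  · change bdry d n _ = 0
    rw [map_add, bdry_oneSubT d T hT0 hTi, hb', add_comm, ht]
  · refine TotCC.ext_succ ?_ (by simp [topEntry_Dtot])
    rw [map_sub, initEntries_colZero, hb, zero_sub]
    cases n with
    | zero => exact TotCC.ext_zero (by simp [topEntry_initEntries_Dtot, hb'])
    | succ n =>
      refine TotCC.ext_succ ?_ (by simp [topEntry_initEntries_Dtot, hb'])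
      rw [initEntries_initEntries_Dtot]
      simp

/-- The chain-level formula `(1 - t) h N` for the connecting map, where `h` contracts `∂'`. -/
def connes (T : ∀ n, C n →+ C n) (s : ∀ n, C n →+ C (n + 1)) (n : ℕ) :
    TotCC C n →+ C (n + 1) :=
  (oneSubT T (n + 1)).comp ((contr s n).comp ((normT T n).comp (topEntry n)))

theorem connes_apply (s : ∀ n, C n →+ C (n + 1)) (n : ℕ) (z : TotCC C n) :
    connes T s n z = oneSubT T (n + 1) (contr s n (normT T n (topEntry n z))) := rfl

theorem bdry'_contr_normT
    (hT : ∀ n, hpow (T n) (n + 1) = AddMonoidHom.id (C n))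
    (hT0 : ∀ n, (d n 0).comp (T (n + 1)) = d n (n + 1))
    (hTi : ∀ n i, 1 ≤ i → i ≤ n + 1 →
      (d n i).comp (T (n + 1)) = (T n).comp (d n (i - 1)))
    (s : ∀ n, C n →+ C (n + 1))
    (hs : ∀ n i, i ≤ n → (d (n + 1) i).comp (s (n + 1)) = (s n).comp (d n i))
    (hsn : ∀ n, (d n n).comp (s n) = AddMonoidHom.id (C n))
    (n : ℕ) (z : TotCC C n) (hz : z ∈ cycTot d T n) :
    bdry' d n (contr s n (normT T n (topEntry n z))) = normT T n (topEntry n z) := by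
  cases n with
  | zero => exact bdry'_zero_contr d s hsn _
  | succ n =>
    have hz0 : Dtot d T n z = 0 := hz
    have h : normT T n (topEntry n (Dtot d T n z)) = 0 := by rw [hz0, map_zero, map_zero]
    rw [topEntry_Dtot, map_add, normT_oneSubT T hT, zero_add] at h
    rw [bdry'_contr d s hs hsn, bdry'_normT d T hT hT0 hTi, h, map_zero, sub_zero]

theorem oneSubT_contr_bdry'
    (hT0 : ∀ n, (d n 0).comp (T (n + 1)) = d n (n + 1))
    (hTi : ∀ n i, 1 ≤ i → i ≤ n + 1 →
      (d n i).comp (T (n + 1)) = (T n).comp (d n (i - 1)))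
    (s : ∀ n, C n →+ C (n + 1))
    (hs : ∀ n i, i ≤ n → (d (n + 1) i).comp (s (n + 1)) = (s n).comp (d n i))
    (hsn : ∀ n, (d n n).comp (s n) = AddMonoidHom.id (C n)) (n : ℕ) (y : C (n + 1)) :
    oneSubT T (n + 1) (contr s n (bdry' d n y)) =
      oneSubT T (n + 1) y - bdry d (n + 1) (oneSubT T (n + 2) (contr s (n + 1) y)) := by
  rw [bdry_oneSubT d T hT0 hTi, bdry'_contr d s hs hsn, map_sub, sub_sub_cancel]

theorem connes_mem_cycC
    (hT : ∀ n, hpow (T n) (n + 1) = AddMonoidHom.id (C n))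
    (hT0 : ∀ n, (d n 0).comp (T (n + 1)) = d n (n + 1))
    (hTi : ∀ n i, 1 ≤ i → i ≤ n + 1 →
      (d n i).comp (T (n + 1)) = (T n).comp (d n (i - 1)))
    (s : ∀ n, C n →+ C (n + 1))
    (hs : ∀ n i, i ≤ n → (d (n + 1) i).comp (s (n + 1)) = (s n).comp (d n i))
    (hsn : ∀ n, (d n n).comp (s n) = AddMonoidHom.id (C n))
    (n : ℕ) (z : TotCC C n) (hz : z ∈ cycTot d T n) :
    connes T s n z ∈ cycC d (n + 1) := by
  change bdry d n _ = 0
  rw [connes_apply, bdry_oneSubT d T hT0 hTi, bdry'_contr_normT d T hT hT0 hTi s hs hsn n z hz,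
    oneSubT_normT T hT]

theorem connes_mem_bdC
    (hT : ∀ n, hpow (T n) (n + 1) = AddMonoidHom.id (C n))
    (hT0 : ∀ n, (d n 0).comp (T (n + 1)) = d n (n + 1))
    (hTi : ∀ n i, 1 ≤ i → i ≤ n + 1 →
      (d n i).comp (T (n + 1)) = (T n).comp (d n (i - 1)))
    (s : ∀ n, C n →+ C (n + 1))
    (hs : ∀ n i, i ≤ n → (d (n + 1) i).comp (s (n + 1)) = (s n).comp (d n i))
    (hsn : ∀ n, (d n n).comp (s n) = AddMonoidHom.id (C n))
    (n : ℕ) (z : TotCC C n) (hz : z ∈ bdTot d T n) :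
    connes T s n z ∈ bdC d (n + 1) := by
  obtain ⟨w, rfl⟩ := hz
  rw [connes_apply, topEntry_Dtot, map_add, normT_oneSubT T hT, zero_add,
    ← bdry'_normT d T hT hT0 hTi, oneSubT_contr_bdry' d T hT0 hTi s hs hsn,
    oneSubT_normT T hT, zero_sub]
  exact neg_mem ⟨_, rfl⟩

end Differential

end CyclicBicomplex

section Subquotient

variable {A A' A'' : Type*} [AddCommGroup A] [AddCommGroup A'] [AddCommGroup A'']

/-- The map induced on the quotients `Z / (B ∩ Z)` of subgroups. -/
def subquotientMap (Z B : AddSubgroup A) (Z' B' : AddSubgroup A') (f : A →+ A')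
    (hZ : ∀ x ∈ Z, f x ∈ Z') (hB : ∀ x ∈ B, f x ∈ B') :
    Z ⧸ B.addSubgroupOf Z →+ Z' ⧸ B'.addSubgroupOf Z' :=
  QuotientAddGroup.map _ _ ((f.comp Z.subtype).codRestrict Z' fun x => hZ x x.2)
    fun x hx => hB x hx

theorem subquotientMap_mk_eq_zero_iff {Z B : AddSubgroup A} {Z' B' : AddSubgroup A'}
    {f : A →+ A'} (hZ : ∀ x ∈ Z, f x ∈ Z') (hB : ∀ x ∈ B, f x ∈ B') (x : Z) :
    subquotientMap Z B Z' B' f hZ hB (QuotientAddGroup.mk x) = 0 ↔ f x ∈ B' :=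
  (QuotientAddGroup.eq_zero_iff (N := B'.addSubgroupOf Z')
    (⟨f x, hZ x x.2⟩ : Z')).trans Iff.rfl

theorem subquotientMap_mk_eq_mk_iff {Z B : AddSubgroup A} {Z' B' : AddSubgroup A'}
    {f : A →+ A'} (hZ : ∀ x ∈ Z, f x ∈ Z') (hB : ∀ x ∈ B, f x ∈ B') (x : Z) (y : Z') :
    subquotientMap Z B Z' B' f hZ hB (QuotientAddGroup.mk x) = QuotientAddGroup.mk y ↔
      f x - y ∈ B' :=
  (QuotientAddGroup.eq_iff_sub_mem (N := B'.addSubgroupOf Z')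
    (x := (⟨f x, hZ x x.2⟩ : Z'))).trans Iff.rfl

theorem subquotientMap_surjective {Z B : AddSubgroup A} {Z' B' : AddSubgroup A'}
    {f : A →+ A'} (hZ : ∀ x ∈ Z, f x ∈ Z') (hB : ∀ x ∈ B, f x ∈ B')
    (h : ∀ y ∈ Z', ∃ x ∈ Z, f x - y ∈ B') :
    Function.Surjective (subquotientMap Z B Z' B' f hZ hB) := by
  intro y
  obtain ⟨y, rfl⟩ := QuotientAddGroup.mk_surjective y
  obtain ⟨x, hx, hxy⟩ := h y y.2
  exact ⟨QuotientAddGroup.mk ⟨x, hx⟩, (subquotientMap_mk_eq_mk_iff hZ hB ⟨x, hx⟩ y).2 hxy⟩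

theorem subquotientMap_injective {Z B : AddSubgroup A} {Z' B' : AddSubgroup A'}
    {f : A →+ A'} (hZ : ∀ x ∈ Z, f x ∈ Z') (hB : ∀ x ∈ B, f x ∈ B')
    (h : ∀ x ∈ Z, f x ∈ B' → x ∈ B) :
    Function.Injective (subquotientMap Z B Z' B' f hZ hB) := by
  rw [injective_iff_map_eq_zero]
  intro x hx
  obtain ⟨x, rfl⟩ := QuotientAddGroup.mk_surjective x
  exact (QuotientAddGroup.eq_zero_iff x).2
    (h x x.2 ((subquotientMap_mk_eq_zero_iff hZ hB x).1 hx))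

theorem subquotientMap_range_eq_ker {Z B : AddSubgroup A} {Z' B' : AddSubgroup A'}
    {Z'' B'' : AddSubgroup A''} {f : A →+ A'} {g : A' →+ A''}
    (hZ : ∀ x ∈ Z, f x ∈ Z') (hB : ∀ x ∈ B, f x ∈ B')
    (hZ' : ∀ x ∈ Z', g x ∈ Z'') (hB' : ∀ x ∈ B', g x ∈ B'')
    (hgf : ∀ x ∈ Z, g (f x) ∈ B'')
    (hex : ∀ y ∈ Z', g y ∈ B'' → ∃ x ∈ Z, f x - y ∈ B') :
    (subquotientMap Z B Z' B' f hZ hB).range = (subquotientMap Z' B' Z'' B'' g hZ' hB').ker := by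
  apply le_antisymm
  · rintro _ ⟨x, rfl⟩
    obtain ⟨x, rfl⟩ := QuotientAddGroup.mk_surjective x
    exact (subquotientMap_mk_eq_zero_iff hZ' hB' ⟨f x, hZ x x.2⟩).2 (hgf x x.2)
  · intro y hy
    obtain ⟨y, rfl⟩ := QuotientAddGroup.mk_surjective y
    obtain ⟨x, hx, hxy⟩ := hex y y.2 ((subquotientMap_mk_eq_zero_iff hZ' hB' y).1 hy)
    exact ⟨QuotientAddGroup.mk ⟨x, hx⟩, (subquotientMap_mk_eq_mk_iff hZ hB ⟨x, hx⟩ y).2 hxy⟩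

end Subquotient

/-- **Connes periodicity.** For a precyclic abelian group
`(C_n, d_i, T_n)` with a last degeneracy `s_n`, there are homomorphisms
`I : H_n → HC_n`, `S : HC_n → HC_{n-2}` and `B : HC_{n-2} → H_{n-1}` fitting into a
long exact sequence `⋯ →B H_n →I HC_n →S HC_{n-2} →B H_{n-1} →I HC_{n-1} → ⋯`
(the sequence ends with `HC_1 → 0 → H_0 → HC_0 → 0`, which accounts for the
surjectivity of `I` in degrees `0, 1` and its injectivity in degree `0`). -/
theorem stmt8 (C : ℕ → Type*) [∀ n, AddCommGroup (C n)]
    (d : ∀ n, ℕ → (C (n + 1) →+ C n))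
    (hd : ∀ n i j, i < j → j ≤ n + 2 →
      (d n i).comp (d (n + 1) j) = (d n (j - 1)).comp (d (n + 1) i))
    (T : ∀ n, C n →+ C n)
    (hT : ∀ n, hpow (T n) (n + 1) = AddMonoidHom.id (C n))
    (hT0 : ∀ n, (d n 0).comp (T (n + 1)) = d n (n + 1))
    (hTi : ∀ n i, 1 ≤ i → i ≤ n + 1 →
      (d n i).comp (T (n + 1)) = (T n).comp (d n (i - 1)))
    (s : ∀ n, C n →+ C (n + 1))
    (hs : ∀ n i, i ≤ n → (d (n + 1) i).comp (s (n + 1)) = (s n).comp (d n i))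
    (hsn : ∀ n, (d n n).comp (s n) = AddMonoidHom.id (C n))
    (hsn1 : ∀ n, (d n (n + 1)).comp (s n) = AddMonoidHom.id (C n)) :
    ∃ (I : ∀ n, Hgrp d n →+ HCgrp d T n)
      (S : ∀ n, HCgrp d T (n + 2) →+ HCgrp d T n)
      (B : ∀ n, HCgrp d T n →+ Hgrp d (n + 1)),
      -- exactness at `HC_{n+2}`
      (∀ n, (I (n + 2)).range = (S n).ker) ∧
      -- exactness at `HC_0` and `HC_1` (where `S` maps to `0`)
      Function.Surjective (I 0) ∧ Function.Surjective (I 1) ∧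
      -- exactness at `HC_n` (as target of `S` and source of `B`)
      (∀ n, (S n).range = (B n).ker) ∧
      -- exactness at `H_{n+1}`
      (∀ n, (B n).range = (I (n + 1)).ker) ∧
      -- exactness at `H_0` (where `B` maps in from `0`)
      Function.Injective (I 0) := by
  have hI0 : ∀ n, ∀ a ∈ bdC d n, colZero n a ∈ bdTot d T n := by
    rintro n _ ⟨a, rfl⟩
    exact ⟨colZero (n + 1) a, Dtot_colZero d T n a⟩
  have hS : ∀ n, ∀ x ∈ cycTot d T (n + 2), shiftTwo n x ∈ cycTot d T n :=
    fun n x hx => ((mem_cycTot_iff d T n x).1 hx).1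
  have hS0 : ∀ n, ∀ x ∈ bdTot d T (n + 2), shiftTwo n x ∈ bdTot d T n := by
    rintro n _ ⟨x, rfl⟩
    exact ⟨_, (initEntries_initEntries_Dtot d T n x).symm⟩
  have hcol := exists_colZero_of_initEntries_eq d T hT0 hTi s hs hsn
  refine ⟨
    fun n => subquotientMap _ _ _ _ (colZero n) (colZero_mem_cycTot d T n) (hI0 n),
    fun n => subquotientMap _ _ _ _ (shiftTwo n) (hS n) (hS0 n),
    fun n => subquotientMap _ _ _ _ (connes T s n)
      (connes_mem_cycC d T hT hT0 hTi s hs hsn n) (connes_mem_bdC d T hT hT0 hTi s hs hsn n),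
    fun n => ?_, ?_, ?_, fun n => ?_, fun n => ?_, ?_⟩
  · apply subquotientMap_range_eq_ker
    · intro a _
      simp [shiftTwo, zero_mem]
    · rintro x hx ⟨w, hw⟩
      set y := Dtot d T (n + 2) (snocEntry (snocEntry w 0) 0) with hy
      have hyB : y ∈ bdTot d T (n + 2) := ⟨_, rfl⟩
      have hxy : initEntries n (initEntries (n + 1) (x - y)) = 0 := by
        rw [map_sub, map_sub, hy, initEntries_initEntries_Dtot, initEntries_snocEntry,
          initEntries_snocEntry, hw]
        exact sub_self _
      obtain ⟨a, ha, hax⟩ := hcol (n + 1) (x - y)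
        (sub_mem hx (bdTot_le_cycTot d T hd hT hT0 hTi _ hyB)) _ (eq_colZero_succ _ hxy)
      refine ⟨a, ha, ?_⟩
      have := sub_mem hax hyB
      rwa [sub_sub, sub_add_cancel] at this
  · apply subquotientMap_surjective
    intro y _
    refine ⟨topEntry 0 y, trivial, ?_⟩
    rw [← eq_colZero_zero, sub_self]
    exact zero_mem _
  · apply subquotientMap_surjective
    intro y hy
    exact hcol 0 y hy _ (eq_colZero_zero _)
  · apply subquotientMap_range_eq_ker
    · intro x hx
      obtain ⟨-, h1, h2⟩ := (mem_cycTot_iff d T n x).1 hx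
      rw [connes_apply, shiftTwo, AddMonoidHom.comp_apply, h1,
        oneSubT_contr_bdry' d T hT0 hTi s hs hsn, eq_neg_of_add_eq_zero_left h2]
      exact sub_mem (neg_mem ⟨_, rfl⟩) ⟨_, rfl⟩
    · rintro z hz ⟨a, ha⟩
      refine ⟨snocEntry (snocEntry z (contr s n (normT T n (topEntry n z)))) (-a), ?_, ?_⟩
      · rw [mem_cycTot_iff]
        simp only [initEntries_snocEntry, topEntry_snocEntry]
        refine ⟨hz, (bdry'_contr_normT d T hT hT0 hTi s hs hsn n z hz).symm, ?_⟩
        rw [map_neg, ha, connes_apply, add_neg_cancel]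
      · simp [shiftTwo, zero_mem]
  · apply subquotientMap_range_eq_ker
    · intro z hz
      refine ⟨snocEntry (snocEntry z (contr s n (normT T n (topEntry n z)))) 0, ?_⟩
      rw [Dtot_eq_colZero_iff]
      simp only [initEntries_snocEntry, topEntry_snocEntry]
      refine ⟨hz, (bdry'_contr_normT d T hT hT0 hTi s hs hsn n z hz).symm, ?_⟩
      rw [map_zero, add_zero, connes_apply]
    · rintro a - ⟨x, hx⟩
      obtain ⟨h0, h1, h2⟩ := (Dtot_eq_colZero_iff d T n x a).1 hx
      refine ⟨shiftTwo n x, h0, ?_⟩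
      rw [connes_apply, shiftTwo, AddMonoidHom.comp_apply, h1,
        oneSubT_contr_bdry' d T hT0 hTi s hs hsn, ← h2, sub_right_comm, sub_add_cancel_left]
      exact sub_mem (neg_mem ⟨_, rfl⟩) ⟨_, rfl⟩
  · apply subquotientMap_injective
    rintro a - ⟨x, hx⟩
    have h := congrArg (topEntry 0) hx
    have ht : oneSubT T 0 = 0 := by
      ext y
      simpa [oneSubT, hpow, sub_eq_zero] using (DFunLike.congr_fun (hT 0) y).symm
    rw [topEntry_Dtot, topEntry_colZero, ht, AddMonoidHom.zero_apply, zero_add] at h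
    exact ⟨_, h⟩
end
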